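/- Let X be a metric space with Borel σ-algebra Σ, let n ∈ ℕ, let a₁,…,aₙ ∈ [0,1] with Σ_{k=1}^n a_k = 1, and let μ₁,…,μₙ be Borel probability measures on X. Then the lower entropy dimension satisfies ldim_E(Σ_{k=1}^n a_k μ_k) ≥ Σ_{k=1}^n a_k ldim_E(μ_k). -/

import Mathlib

open MeasureTheory ENNReal

/-- The Shannon function `sh(x) = -x·log₂ x` (with `sh 0 = 0`). -/
noncomputable def sh (x : ℝ) : ℝ := -(x * Real.logb 2 x)

/-- `P` is a `μ`-partition of `X`: a countable family of pairwise disjoint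
measurable sets covering `X` up to a `μ`-null set. -/
def IsMuPartition {X : Type*} [MeasurableSpace X] (μ : Measure X) (P : Set (Set X)) : Prop :=
  P.Countable ∧ (∀ s ∈ P, MeasurableSet s) ∧ P.Pairwise Disjoint ∧ μ (⋃₀ P)ᶜ = 0

/-- The `μ`-entropy `h(μ;P) = Σ_{P∈P} sh(μ(P))` of a family of sets. -/
noncomputable def partEntropy {X : Type*} [MeasurableSpace X] (μ : Measure X)
    (P : Set (Set X)) : ℝ≥0∞ :=
  ∑' s : P, ENNReal.ofReal (sh (μ s).toReal)

/-- `P ≺ Q` : every element of `P` is contained in some element of `Q`. -/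
def Finer {X : Type*} (P Q : Set (Set X)) : Prop := ∀ p ∈ P, ∃ q ∈ Q, p ⊆ q

/-- The (classical) `μ`-entropy of a family `Q`:
`H(μ;Q) = inf { h(μ;P) : P a μ-partition, P ≺ Q }`, with `inf ∅ = ∞`. -/
noncomputable def entropyH {X : Type*} [MeasurableSpace X] (μ : Measure X)
    (Q : Set (Set X)) : ℝ≥0∞ :=
  ⨅ (P : Set (Set X)) (_ : IsMuPartition μ P) (_ : Finer P Q), partEntropy μ P

/-- `m ∈ V(μ;Q)` : a weighting of `Q`, i.e. `m : Q → Measure X` with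
`m_Q(X \ Q) = 0` for all `Q ∈ Q` and `Σ_{Q∈Q} m_Q = μ`. -/
def IsWeighting {X : Type*} [MeasurableSpace X] (μ : Measure X) (Q : Set (Set X))
    (m : Q → Measure X) : Prop :=
  (∀ q : Q, m q ((q : Set X))ᶜ = 0) ∧ Measure.sum m = μ

/-- The weighted `μ`-entropy of `m ∈ V(μ;Q)` : `hv(μ;m) = Σ_{Q∈Q} sh(m_Q(X))`. -/
noncomputable def wEntropy {X : Type*} [MeasurableSpace X] (Q : Set (Set X))
    (m : Q → Measure X) : ℝ≥0∞ :=
  ∑' q : Q, ENNReal.ofReal (sh ((m q) Set.univ).toReal)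

/-- The weighted `μ`-entropy of `Q` : `Hv(μ;Q) = inf { hv(μ;m) : m ∈ V(μ;Q) }`,
with `inf ∅ = ∞`. -/
noncomputable def entropyHv {X : Type*} [MeasurableSpace X] (μ : Measure X)
    (Q : Set (Set X)) : ℝ≥0∞ :=
  ⨅ (m : Q → Measure X) (_ : IsWeighting μ Q m), wEntropy Q m

/-- The family of all closed balls of radius `δ`. -/
def ballFam (X : Type*) [PseudoMetricSpace X] (δ : ℝ) : Set (Set X) :=
  Set.range (fun x : X => Metric.closedBall x δ)

/-- The lower entropy dimension `liminf_{δ→0⁺} H(μ;B_δ)/(-log₂ δ)`. -/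
noncomputable def ldimE {X : Type*} [PseudoMetricSpace X] [MeasurableSpace X]
    (μ : Measure X) : ℝ≥0∞ :=
  Filter.liminf (fun δ : ℝ => entropyH μ (ballFam X δ) / ENNReal.ofReal (-Real.logb 2 δ))
    (nhdsWithin 0 (Set.Ioi 0))

/-- The upper entropy dimension `limsup_{δ→0⁺} H(μ;B_δ)/(-log₂ δ)`. -/
noncomputable def udimE {X : Type*} [PseudoMetricSpace X] [MeasurableSpace X]
    (μ : Measure X) : ℝ≥0∞ :=
  Filter.limsup (fun δ : ℝ => entropyH μ (ballFam X δ) / ENNReal.ofReal (-Real.logb 2 δ))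
    (nhdsWithin 0 (Set.Ioi 0))

/-- `N_δ(S)` : the smallest number of closed balls of radius `δ` needed to cover `S`. -/
noncomputable def coverNum {X : Type*} [PseudoMetricSpace X] (S : Set X) (δ : ℝ) : ℝ≥0∞ :=
  ⨅ (t : Finset X) (_ : S ⊆ ⋃ x ∈ t, Metric.closedBall x δ), (t.card : ℝ≥0∞)

/-- The natural logarithm on `ℝ≥0∞` (with `log ∞ = ∞`), truncated to `ℝ≥0∞`. -/
noncomputable def logENN (x : ℝ≥0∞) : ℝ≥0∞ :=
  if x = ⊤ then ⊤ else ENNReal.ofReal (Real.log x.toReal)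

/-- The upper box dimension `limsup_{δ→0⁺} log N_δ(S)/(-log δ)`. -/
noncomputable def ubdimB {X : Type*} [PseudoMetricSpace X] (S : Set X) : ℝ≥0∞ :=
  Filter.limsup (fun δ : ℝ => logENN (coverNum S δ) / ENNReal.ofReal (-Real.log δ))
    (nhdsWithin 0 (Set.Ioi 0))

/-- The upper local dimension `D̄_μ(x) = limsup_{δ→0⁺} log μ(B(x,δ))/log δ`
(interpreted as `∞` when `μ(B(x,δ)) = 0`). -/
noncomputable def upLocalDim {X : Type*} [PseudoMetricSpace X] [MeasurableSpace X]
    (μ : Measure X) (x : X) : ℝ≥0∞ :=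
  Filter.limsup
    (fun δ : ℝ => if μ (Metric.closedBall x δ) = 0 then ⊤ else
      ENNReal.ofReal (Real.log (μ (Metric.closedBall x δ)).toReal / Real.log δ))
    (nhdsWithin 0 (Set.Ioi 0))

open Filter in
/-- The lower limit is superadditive in `ℝ≥0∞`. -/
theorem ENNReal.liminf_add_liminf_le {α : Type*} {f : Filter α} (u v : α → ℝ≥0∞) :
    liminf u f + liminf v f ≤ liminf (fun x => u x + v x) f := by
  rw [liminf_eq_iSup_iInf (u := u), liminf_eq_iSup_iInf (u := v)]
  simp only [iSup_subtype']
  refine ENNReal.iSup_add_iSup_le fun s t => ?_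
  refine le_liminf_of_le (by isBoundedDefault) ?_
  filter_upwards [s.2, t.2] with x hs ht
  exact add_le_add (iInf₂_le x hs) (iInf₂_le x ht)

open Filter in
/-- The lower limit is superadditive over finite sums in `ℝ≥0∞`. -/
theorem ENNReal.sum_liminf_le {α ι : Type*} {f : Filter α} (s : Finset ι) (u : ι → α → ℝ≥0∞) :
    ∑ i ∈ s, liminf (u i) f ≤ liminf (fun x => ∑ i ∈ s, u i x) f := by
  classical
  induction s using Finset.induction_on with
  | empty => simp
  | insert i s hi ih =>
    simp only [Finset.sum_insert hi]
    exact (add_le_add_right ih _).trans (ENNReal.liminf_add_liminf_le _ _)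

theorem sh_eq_negMulLog_div (x : ℝ) : sh x = Real.negMulLog x / Real.log 2 := by
  simp only [sh, Real.negMulLog, Real.logb]
  ring

theorem sh_nonneg {x : ℝ} (h0 : 0 ≤ x) (h1 : x ≤ 1) : 0 ≤ sh x := by
  rw [sh_eq_negMulLog_div]
  exact div_nonneg (Real.negMulLog_nonneg h0 h1) (Real.log_nonneg (by norm_num))

theorem concaveOn_sh : ConcaveOn ℝ (Set.Ici 0) sh := by
  have h : sh = (Real.log 2)⁻¹ • Real.negMulLog := by
    ext x
    rw [sh_eq_negMulLog_div, div_eq_inv_mul, Pi.smul_apply, smul_eq_mul]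
  rw [h]
  exact Real.concaveOn_negMulLog.smul (inv_nonneg.2 (Real.log_nonneg (by norm_num)))

section Mixture

variable {X ι : Type*} [MeasurableSpace X] [Fintype ι] {a : ι → ℝ} {μ : ι → Measure X}

theorem mixture_apply (a : ι → ℝ) (μ : ι → Measure X) (s : Set X) :
    (∑ k, ENNReal.ofReal (a k) • μ k) s = ∑ k, ENNReal.ofReal (a k) * μ k s := by
  simp [Measure.finsetSum_apply]

theorem ofReal_sh_mixture_ge (ha : ∀ k, 0 ≤ a k) (hsum : ∑ k, a k = 1)
    (hμ : ∀ k, IsProbabilityMeasure (μ k)) (s : Set X) :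
    ∑ k, ENNReal.ofReal (a k) * ENNReal.ofReal (sh (μ k s).toReal) ≤
      ENNReal.ofReal (sh ((∑ k, ENNReal.ofReal (a k) • μ k) s).toReal) := by
  have hs : ∀ k, 0 ≤ sh (μ k s).toReal := fun k =>
    sh_nonneg ENNReal.toReal_nonneg (ENNReal.toReal_mono ENNReal.one_ne_top prob_le_one)
  have hm : ((∑ k, ENNReal.ofReal (a k) • μ k) s).toReal = ∑ k, a k * (μ k s).toReal := by
    rw [mixture_apply, ENNReal.toReal_sum fun k _ =>
      ENNReal.mul_ne_top ENNReal.ofReal_ne_top (measure_ne_top _ _)]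
    simp [ENNReal.toReal_ofReal (ha _)]
  simp_rw [← ENNReal.ofReal_mul (ha _)]
  rw [← ENNReal.ofReal_sum_of_nonneg fun k _ => mul_nonneg (ha k) (hs k), hm]
  exact ENNReal.ofReal_le_ofReal
    (concaveOn_sh.le_map_sum (fun k _ => ha k) hsum fun k _ => ENNReal.toReal_nonneg)

theorem partEntropy_mixture_ge (ha : ∀ k, 0 ≤ a k) (hsum : ∑ k, a k = 1)
    (hμ : ∀ k, IsProbabilityMeasure (μ k)) (P : Set (Set X)) :
    ∑ k, ENNReal.ofReal (a k) * partEntropy (μ k) P ≤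
      partEntropy (∑ k, ENNReal.ofReal (a k) • μ k) P := by
  simp only [partEntropy, ← ENNReal.tsum_mul_left]
  rw [← Summable.tsum_finsetSum fun _ _ => ENNReal.summable]
  exact ENNReal.tsum_le_tsum fun s => ofReal_sh_mixture_ge ha hsum hμ s

theorem IsMuPartition.of_mixture {P : Set (Set X)}
    (hP : IsMuPartition (∑ k, ENNReal.ofReal (a k) • μ k) P) {k : ι} (hk : 0 < a k) :
    IsMuPartition (μ k) P := by
  obtain ⟨hc, hm, hd, h0⟩ := hP
  refine ⟨hc, hm, hd, ?_⟩
  rw [mixture_apply, Finset.sum_eq_zero_iff] at h0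
  exact (mul_eq_zero.1 (h0 k (Finset.mem_univ k))).resolve_left (ENNReal.ofReal_pos.2 hk).ne'

theorem entropyH_mixture_ge (ha : ∀ k, 0 ≤ a k) (hsum : ∑ k, a k = 1)
    (hμ : ∀ k, IsProbabilityMeasure (μ k)) (Q : Set (Set X)) :
    ∑ k, ENNReal.ofReal (a k) * entropyH (μ k) Q ≤
      entropyH (∑ k, ENNReal.ofReal (a k) • μ k) Q := by
  refine le_iInf fun P => le_iInf fun hP => le_iInf fun hPQ => ?_
  refine (Finset.sum_le_sum fun k _ => ?_).trans (partEntropy_mixture_ge ha hsum hμ P)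
  rcases (ha k).eq_or_lt with hk | hk
  · simp [← hk]
  · gcongr
    exact iInf_le_of_le P (iInf₂_le (hP.of_mixture hk) hPQ)

end Mixture

/-- first inequality of Theorem 3 of the paper: the lower entropy dimension
of a finite mixture satisfies `ldim_E(Σ_k a_k μ_k) ≥ Σ_k a_k ldim_E(μ_k)`. -/
theorem ldimE_mixture_ge {X : Type*} [MetricSpace X] [MeasurableSpace X] [BorelSpace X]
    (n : ℕ) (a : Fin n → ℝ) (ha : ∀ k, a k ∈ Set.Icc (0 : ℝ) 1) (hsum : ∑ k, a k = 1)
    (μ : Fin n → Measure X) (hμ : ∀ k, IsProbabilityMeasure (μ k)) :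
    ∑ k, ENNReal.ofReal (a k) * ldimE (μ k) ≤
      ldimE (∑ k, ENNReal.ofReal (a k) • μ k) := by
  simp only [ldimE, ← ENNReal.liminf_const_mul_of_ne_top ENNReal.ofReal_ne_top]
  refine (ENNReal.sum_liminf_le _ _).trans (Filter.liminf_le_liminf (.of_forall fun δ => ?_))
  simp only [div_eq_mul_inv, ← mul_assoc, ← Finset.sum_mul]
  gcongr
  exact entropyH_mixture_ge (fun k => (ha k).1) hsum hμ _
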